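/- Let A be a symmetric skew left brace, I an ideal of A, and n ≥ 1. Then A/I is n-isoclinic to A/(I ∩ Γ_{n+1}(A)); in particular, if I ∩ Γ_{n+1}(A) = 1, then A and A/I are n-isoclinic. Conversely, if Γ_{n+1}(A) is finite and A and A/I are n-isoclinic, then I ∩ Γ_{n+1}(A) = 1. -/

import Mathlib

set_option linter.unusedVariables false

universe u v

/-- A skew left brace: a carrier with two group structures `(A,·)` (written `dmul`) and
`(A,∘)` (written `cmul`) sharing the same identity `ident`, satisfying
`a ∘ (b · c) = (a ∘ b) · a⁻¹ · (a ∘ c)`. -/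
class SkewBrace (A : Type u) where
  dmul : A → A → A
  ident : A
  dinv : A → A
  cmul : A → A → A
  cinv : A → A
  dmul_assoc : ∀ a b c : A, dmul (dmul a b) c = dmul a (dmul b c)
  ident_dmul : ∀ a : A, dmul ident a = a
  dmul_ident : ∀ a : A, dmul a ident = a
  dinv_dmul : ∀ a : A, dmul (dinv a) a = ident
  dmul_dinv : ∀ a : A, dmul a (dinv a) = ident
  cmul_assoc : ∀ a b c : A, cmul (cmul a b) c = cmul a (cmul b c)
  ident_cmul : ∀ a : A, cmul ident a = a
  cmul_ident : ∀ a : A, cmul a ident = a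
  cinv_cmul : ∀ a : A, cmul (cinv a) a = ident
  cmul_cinv : ∀ a : A, cmul a (cinv a) = ident
  compat : ∀ a b c : A, cmul a (dmul b c) = dmul (dmul (cmul a b) (dinv a)) (cmul a c)

namespace SkewBrace

variable {A : Type u} [SkewBrace A]

/-- The lambda map `λ_a(b) = a⁻¹ · (a ∘ b)`. -/
def lam (a b : A) : A := dmul (dinv a) (cmul a b)

/-- The star operation `a * b = λ_a(b) · b⁻¹`. -/
def bstar (a b : A) : A := dmul (lam a b) (dinv b)

/-- The dot commutator `[a,b]· = a · b · a⁻¹ · b⁻¹`. -/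
def dcomm (a b : A) : A := dmul (dmul (dmul a b) (dinv a)) (dinv b)

/-- The circle commutator `[a,b]∘ = a ∘ b ∘ ā ∘ b̄`. -/
def ccomm (a b : A) : A := cmul (cmul (cmul a b) (cinv a)) (cinv b)

/-- Membership in the subgroup of `(A,·)` generated by a subset. -/
inductive dclosure (S : Set A) : A → Prop
  | mem {x : A} : x ∈ S → dclosure S x
  | one : dclosure S ident
  | mul {x y : A} : dclosure S x → dclosure S y → dclosure S (dmul x y)
  | inv {x : A} : dclosure S x → dclosure S (dinv x)

/-- The subgroup of `(A,·)` generated by a subset, as a set. -/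
def dcl (S : Set A) : Set A := {x | dclosure S x}

/-- Membership in the subgroup of `(A,∘)` generated by a subset. -/
inductive cclosure (S : Set A) : A → Prop
  | mem {x : A} : x ∈ S → cclosure S x
  | one : cclosure S ident
  | mul {x y : A} : cclosure S x → cclosure S y → cclosure S (cmul x y)
  | inv {x : A} : cclosure S x → cclosure S (cinv x)

/-- The subgroup of `(A,∘)` generated by a subset, as a set. -/
def ccl (S : Set A) : Set A := {x | cclosure S x}

/-- The set `{x * y : x ∈ I, y ∈ J}` (star values). -/
def starSet (I J : Set A) : Set A := {x | ∃ a ∈ I, ∃ b ∈ J, x = bstar a b}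

/-- The set of dot commutators `[a,b]·` with `a ∈ I`, `b ∈ J`. -/
def dcommSet (I J : Set A) : Set A := {x | ∃ a ∈ I, ∃ b ∈ J, x = dcomm a b}

/-- The set of circle commutators `[a,b]∘` with `a ∈ I`, `b ∈ J`. -/
def ccommSet (I J : Set A) : Set A := {x | ∃ a ∈ I, ∃ b ∈ J, x = ccomm a b}

/-- The lower central series `Γ_n(A)` of the skew brace `A` (`Gamma A n = Γ_n(A)` for `n ≥ 1`):
`Γ₁(A) = A` and `Γ_n(A) = ⟨A * Γ_{n-1}(A), Γ_{n-1}(A) * A, [A,Γ_{n-1}(A)]·⟩·`. -/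
def Gamma (A : Type u) [SkewBrace A] : ℕ → Set A
  | 0 => Set.univ
  | 1 => Set.univ
  | (n+2) =>
      dcl (starSet Set.univ (Gamma A (n+1)) ∪ starSet (Gamma A (n+1)) Set.univ ∪
        dcommSet Set.univ (Gamma A (n+1)))

/-- The lower central series `γ_n(A,∘)` of the group `(A,∘)`
(`gammaCirc A n = γ_n(A,∘)` for `n ≥ 1`). -/
def gammaCirc (A : Type u) [SkewBrace A] : ℕ → Set A
  | 0 => Set.univ
  | 1 => Set.univ
  | (n+2) => ccl (ccommSet (gammaCirc A (n+1)) Set.univ)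

/-- The series `Γ̄_n(A)`: `Γ̄₁(A) = A`, `Γ̄_n(A) = ⟨A * Γ̄_{n-1}(A), [A, Γ̄_{n-1}(A)]·⟩·`. -/
def GammaBar (A : Type u) [SkewBrace A] : ℕ → Set A
  | 0 => Set.univ
  | 1 => Set.univ
  | (n+2) =>
      dcl (starSet Set.univ (GammaBar A (n+1)) ∪ dcommSet Set.univ (GammaBar A (n+1)))

/-- The annihilator series: `AnnS A n = Ann_n(A)`, with `Ann_0(A) = 1` and
`Ann_n(A) = {a | a*b, b*a, [a,b]· ∈ Ann_{n-1}(A) for all b}`. -/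
def AnnS (A : Type u) [SkewBrace A] : ℕ → Set A
  | 0 => {ident}
  | (n+1) => {a | ∀ b : A, bstar a b ∈ AnnS A n ∧ bstar b a ∈ AnnS A n ∧ dcomm a b ∈ AnnS A n}

/-- The alphabet `X = {γ·, γ̄·, *, *̄}` of brace commutator symbols. -/
inductive BWord : Type
  | g | gbar | s | sbar

/-- Evaluation of a single symbol of `X`. -/
def evalX : BWord → A → A → A
  | BWord.g => dcomm
  | BWord.gbar => fun a b => dcomm b a
  | BWord.s => bstar
  | BWord.sbar => fun a b => bstar b a

/-- `evalW e a n` is the value `m(a₀ a₁ ⋯ a_n)` of the degree-`n` brace commutator word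
`m = (e 0)(e 1)⋯(e (n-1))` on the arguments `a 0, …, a n`:
`m(a₀ ⋯ a_n) = (e 0)(a₀, (e 1)(a₁, …, (e (n-1))(a_{n-1}, a_n)⋯))`. -/
def evalW : (ℕ → BWord) → (ℕ → A) → ℕ → A
  | _, a, 0 => a 0
  | e, a, (n+1) => evalX (e 0) (a 0) (evalW (fun i => e (i+1)) (fun i => a (i+1)) n)

/-- `Asub A t = A_{(t)}`, the subgroup of `(A,·)` generated by all values of brace commutator
words of degree `≥ t`. -/
def Asub (A : Type u) [SkewBrace A] (t : ℕ) : Set A :=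
  dcl {x | ∃ s : ℕ, t ≤ s ∧ ∃ (e : ℕ → BWord) (a : ℕ → A), x = evalW e a s}

/-- `Sset A r = S_r(A)`, the set of all values of brace commutator words of degree exactly `r`
(`S_0(A) = A`). -/
def Sset (A : Type u) [SkewBrace A] (r : ℕ) : Set A :=
  {x | ∃ (e : ℕ → BWord) (a : ℕ → A), x = evalW e a r}

/-- `cosetRel I a b` says that `b` lies in the coset `I · a`. -/
def cosetRel (I : Set A) (a b : A) : Prop := ∃ c ∈ I, b = dmul c a

/-- The class `I_n`: the maps `φ_m : (A/Ann_n(A))^{n+1} → A_{(n)}`,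
`(Ann_n(A)a₁, …, Ann_n(A)a_{n+1}) ↦ m(a₁⋯a_{n+1})`, are well defined for every word `m` of
degree `n`. -/
def InClass (A : Type u) [SkewBrace A] (n : ℕ) : Prop :=
  ∀ (e : ℕ → BWord) (a b : ℕ → A),
    (∀ i : ℕ, i ≤ n → cosetRel (AnnS A n) (a i) (b i)) →
    evalW e b n = evalW e a n

/-- A skew left brace `(A,·,∘)` is symmetric if `(A,∘,·)` is also a skew left brace, i.e.
`a · (b ∘ c) = (a · b) ∘ ā ∘ (a · c)`. -/
def IsSymmetric (A : Type u) [SkewBrace A] : Prop :=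
  ∀ a b c : A, dmul a (cmul b c) = cmul (cmul (dmul a b) (cinv a)) (dmul a c)

/-- A sub-skew brace: a subset which is a subgroup of both `(A,·)` and `(A,∘)`. -/
structure IsSubBrace (A : Type u) [SkewBrace A] (S : Set A) : Prop where
  ident_mem : ident ∈ S
  dmul_mem : ∀ {x y : A}, x ∈ S → y ∈ S → dmul x y ∈ S
  dinv_mem : ∀ {x : A}, x ∈ S → dinv x ∈ S
  cmul_mem : ∀ {x y : A}, x ∈ S → y ∈ S → cmul x y ∈ S
  cinv_mem : ∀ {x : A}, x ∈ S → cinv x ∈ S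

/-- An ideal of a skew brace: a subgroup of `(A,·)`, normal in `(A,·)` and `(A,∘)`,
and invariant under all `λ_a`. -/
structure IsIdeal (A : Type u) [SkewBrace A] (I : Set A) : Prop where
  ident_mem : ident ∈ I
  dmul_mem : ∀ {x y : A}, x ∈ I → y ∈ I → dmul x y ∈ I
  dinv_mem : ∀ {x : A}, x ∈ I → dinv x ∈ I
  dconj_mem : ∀ (a : A) {x : A}, x ∈ I → dmul (dmul a x) (dinv a) ∈ I
  cconj_mem : ∀ (a : A) {x : A}, x ∈ I → cmul (cmul a x) (cinv a) ∈ I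
  lam_mem : ∀ (a : A) {x : A}, x ∈ I → lam a x ∈ I

/-- A homomorphism of skew braces. -/
structure IsBraceHom {A : Type u} {B : Type v} [SkewBrace A] [SkewBrace B] (f : A → B) : Prop where
  map_dmul : ∀ x y : A, f (dmul x y) = dmul (f x) (f y)
  map_cmul : ∀ x y : A, f (cmul x y) = cmul (f x) (f y)

/-- The data of an isoclinism of skew braces along ideals `I` of `A` and `J` of `B`:
`ξ` induces a brace isomorphism `A/I → B/J` and `θ` restricts to a brace isomorphism
`Γ₂(A) → Γ₂(B)` compatible with the commutator and star maps. -/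
structure IsoclinismData (A : Type u) (B : Type v) [SkewBrace A] [SkewBrace B]
    (I : Set A) (J : Set B) (ξ θ : A → B) : Prop where
  xi_resp : ∀ a a' : A, cosetRel I a a' ↔ cosetRel J (ξ a) (ξ a')
  xi_surj : ∀ b : B, ∃ a : A, cosetRel J b (ξ a)
  xi_dmul : ∀ a a' : A, cosetRel J (dmul (ξ a) (ξ a')) (ξ (dmul a a'))
  xi_cmul : ∀ a a' : A, cosetRel J (cmul (ξ a) (ξ a')) (ξ (cmul a a'))
  theta_maps : ∀ x ∈ Gamma A 2, θ x ∈ Gamma B 2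
  theta_inj : ∀ x ∈ Gamma A 2, ∀ y ∈ Gamma A 2, θ x = θ y → x = y
  theta_surj : ∀ y ∈ Gamma B 2, ∃ x ∈ Gamma A 2, θ x = y
  theta_dmul : ∀ x ∈ Gamma A 2, ∀ y ∈ Gamma A 2, θ (dmul x y) = dmul (θ x) (θ y)
  theta_cmul : ∀ x ∈ Gamma A 2, ∀ y ∈ Gamma A 2, θ (cmul x y) = cmul (θ x) (θ y)
  compat_dcomm : ∀ a₁ a₂ : A, ∀ b₁ b₂ : B, cosetRel J b₁ (ξ a₁) → cosetRel J b₂ (ξ a₂) →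
    θ (dcomm a₁ a₂) = dcomm b₁ b₂
  compat_star : ∀ a₁ a₂ : A, ∀ b₁ b₂ : B, cosetRel J b₁ (ξ a₁) → cosetRel J b₂ (ξ a₂) →
    θ (bstar a₁ a₂) = bstar b₁ b₂

/-- Isoclinism (1-isoclinism) of skew left braces. -/
def Isoclinic (A : Type u) (B : Type v) [SkewBrace A] [SkewBrace B] : Prop :=
  ∃ ξ θ : A → B, IsoclinismData A B (AnnS A 1) (AnnS B 1) ξ θ

/-- The data of an `n`-isoclinism of skew braces: `ξ` induces a brace isomorphism
`A/Ann_n(A) → B/Ann_n(B)` and `θ` restricts to a brace isomorphism `A_{(n)} → B_{(n)}`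
commuting with all brace commutator word maps of degree `n`. -/
structure IsoclinismDataN (A : Type u) (B : Type v) [SkewBrace A] [SkewBrace B]
    (n : ℕ) (ξ θ : A → B) : Prop where
  xi_resp : ∀ a a' : A, cosetRel (AnnS A n) a a' ↔ cosetRel (AnnS B n) (ξ a) (ξ a')
  xi_surj : ∀ b : B, ∃ a : A, cosetRel (AnnS B n) b (ξ a)
  xi_dmul : ∀ a a' : A, cosetRel (AnnS B n) (dmul (ξ a) (ξ a')) (ξ (dmul a a'))
  xi_cmul : ∀ a a' : A, cosetRel (AnnS B n) (cmul (ξ a) (ξ a')) (ξ (cmul a a'))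
  theta_maps : ∀ x ∈ Asub A n, θ x ∈ Asub B n
  theta_inj : ∀ x ∈ Asub A n, ∀ y ∈ Asub A n, θ x = θ y → x = y
  theta_surj : ∀ y ∈ Asub B n, ∃ x ∈ Asub A n, θ x = y
  theta_dmul : ∀ x ∈ Asub A n, ∀ y ∈ Asub A n, θ (dmul x y) = dmul (θ x) (θ y)
  theta_cmul : ∀ x ∈ Asub A n, ∀ y ∈ Asub A n, θ (cmul x y) = cmul (θ x) (θ y)
  compat : ∀ (e : ℕ → BWord) (a : ℕ → A) (b : ℕ → B),
    (∀ i : ℕ, i ≤ n → cosetRel (AnnS B n) (b i) (ξ (a i))) →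
    θ (evalW e a n) = evalW e b n

/-- `n`-isoclinism of skew left braces. -/
def IsoclinicN (A : Type u) (B : Type v) [SkewBrace A] [SkewBrace B] (n : ℕ) : Prop :=
  ∃ ξ θ : A → B, IsoclinismDataN A B n ξ θ

/-- The product set `S · T = {s · t : s ∈ S, t ∈ T}` in `(A,·)`. -/
def setDProd (S T : Set A) : Set A := {x | ∃ s ∈ S, ∃ t ∈ T, x = dmul s t}

/-- The product set `S ∘ T = {s ∘ t : s ∈ S, t ∈ T}` in `(A,∘)`. -/
def setCProd (S T : Set A) : Set A := {x | ∃ s ∈ S, ∃ t ∈ T, x = cmul s t}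

/-- The skew brace structure on a sub-skew brace. -/
def subBrace (S : Set A) (h : IsSubBrace A S) : SkewBrace S where
  dmul x y := ⟨dmul x.1 y.1, h.dmul_mem x.2 y.2⟩
  ident := ⟨ident, h.ident_mem⟩
  dinv x := ⟨dinv x.1, h.dinv_mem x.2⟩
  cmul x y := ⟨cmul x.1 y.1, h.cmul_mem x.2 y.2⟩
  cinv x := ⟨cinv x.1, h.cinv_mem x.2⟩
  dmul_assoc a b c := Subtype.ext (dmul_assoc a.1 b.1 c.1)
  ident_dmul a := Subtype.ext (ident_dmul a.1)
  dmul_ident a := Subtype.ext (dmul_ident a.1)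
  dinv_dmul a := Subtype.ext (dinv_dmul a.1)
  dmul_dinv a := Subtype.ext (dmul_dinv a.1)
  cmul_assoc a b c := Subtype.ext (cmul_assoc a.1 b.1 c.1)
  ident_cmul a := Subtype.ext (ident_cmul a.1)
  cmul_ident a := Subtype.ext (cmul_ident a.1)
  cinv_cmul a := Subtype.ext (cinv_cmul a.1)
  cmul_cinv a := Subtype.ext (cmul_cinv a.1)
  compat a b c := Subtype.ext (compat a.1 b.1 c.1)

/-- The direct product of two skew braces, with componentwise operations. -/
instance prodBrace (A : Type u) (B : Type v) [SkewBrace A] [SkewBrace B] :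
    SkewBrace (A × B) where
  dmul p q := (dmul p.1 q.1, dmul p.2 q.2)
  ident := (ident, ident)
  dinv p := (dinv p.1, dinv p.2)
  cmul p q := (cmul p.1 q.1, cmul p.2 q.2)
  cinv p := (cinv p.1, cinv p.2)
  dmul_assoc a b c := Prod.ext_iff.mpr ⟨dmul_assoc _ _ _, dmul_assoc _ _ _⟩
  ident_dmul a := Prod.ext_iff.mpr ⟨ident_dmul _, ident_dmul _⟩
  dmul_ident a := Prod.ext_iff.mpr ⟨dmul_ident _, dmul_ident _⟩
  dinv_dmul a := Prod.ext_iff.mpr ⟨dinv_dmul _, dinv_dmul _⟩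
  dmul_dinv a := Prod.ext_iff.mpr ⟨dmul_dinv _, dmul_dinv _⟩
  cmul_assoc a b c := Prod.ext_iff.mpr ⟨cmul_assoc _ _ _, cmul_assoc _ _ _⟩
  ident_cmul a := Prod.ext_iff.mpr ⟨ident_cmul _, ident_cmul _⟩
  cmul_ident a := Prod.ext_iff.mpr ⟨cmul_ident _, cmul_ident _⟩
  cinv_cmul a := Prod.ext_iff.mpr ⟨cinv_cmul _, cinv_cmul _⟩
  cmul_cinv a := Prod.ext_iff.mpr ⟨cmul_cinv _, cmul_cinv _⟩
  compat a b c := Prod.ext_iff.mpr ⟨compat _ _ _, compat _ _ _⟩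

end SkewBrace

namespace SkewBrace

section Helpers

/-- The group `(A,·)` underlying a skew brace. -/
@[reducible] def dotGroup (A : Type u) [SkewBrace A] : Group A where
  mul := dmul
  one := ident
  inv := dinv
  mul_assoc := dmul_assoc
  one_mul := ident_dmul
  mul_one := dmul_ident
  inv_mul_cancel := dinv_dmul

attribute [local instance] dotGroup

variable {A : Type u} [SkewBrace A]

theorem dmul_eq_mul (a b : A) : dmul a b = a * b := rfl

theorem ident_eq_one : (ident : A) = 1 := rfl

theorem dinv_eq_inv (a : A) : dinv a = a⁻¹ := rfl

theorem lam_def (a b : A) : lam a b = a⁻¹ * cmul a b := rfl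

theorem bstar_def (a b : A) : bstar a b = lam a b * b⁻¹ := rfl

theorem dcomm_def (a b : A) : dcomm a b = a * b * a⁻¹ * b⁻¹ := rfl

theorem cmul_eq (a b : A) : cmul a b = a * lam a b := by
  rw [lam_def, mul_inv_cancel_left]

theorem lam_mul (a b c : A) : lam a (b * c) = lam a b * lam a c := by
  have h : cmul a (b * c) = cmul a b * a⁻¹ * cmul a c := compat a b c
  simp only [lam_def, h, mul_assoc]

theorem lam_one (a : A) : lam a 1 = 1 := by
  have h := lam_mul a 1 1
  rwa [one_mul, left_eq_mul] at h

theorem lam_inv (a b : A) : lam a b⁻¹ = (lam a b)⁻¹ := by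
  rw [eq_inv_iff_mul_eq_one, ← lam_mul, inv_mul_cancel, lam_one]

theorem one_lam (a : A) : lam 1 a = a := by
  have h : cmul 1 a = a := ident_cmul a
  rw [lam_def, h, inv_one, one_mul]

theorem cmul_lam (a b c : A) : lam (cmul a b) c = lam a (lam b c) := by
  have h : cmul (cmul a b) c = cmul a (cmul b c) := cmul_assoc a b c
  rw [cmul_eq (cmul a b) c, cmul_eq b c, cmul_eq a b, cmul_eq a, lam_mul, ← mul_assoc] at h
  rw [cmul_eq]
  exact mul_left_cancel h

/-- In a symmetric skew brace `λ` is an anti-homomorphism on `(A,·)`. -/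
theorem IsSymmetric.mul_lam (hA : IsSymmetric A) (a b c : A) :
    lam (a * b) c = lam b (lam a c) := by
  have h : a * cmul b (lam a c) = cmul (cmul (a * b) (cinv a)) (a * lam a c) := hA a b (lam a c)
  have h1 : cmul (cinv a) (cmul a c) = c := by
    rw [← cmul_assoc, cinv_cmul, ident_cmul]
  rw [← cmul_eq a c, cmul_assoc, h1, cmul_eq b, cmul_eq (a * b) c, ← mul_assoc] at h
  exact (mul_left_cancel h).symm

theorem IsSymmetric.inv_lam_cancel (hA : IsSymmetric A) (a c : A) :
    lam a⁻¹ (lam a c) = c := by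
  rw [← hA.mul_lam, mul_inv_cancel, one_lam]

theorem IsSymmetric.lam_inv_cancel (hA : IsSymmetric A) (a c : A) :
    lam a (lam a⁻¹ c) = c := by
  rw [← hA.mul_lam, inv_mul_cancel, one_lam]

theorem IsSymmetric.lam_lam (hA : IsSymmetric A) (a w c : A) :
    lam (lam a w) c = lam a (lam w (lam a⁻¹ c)) := by
  rw [← cmul_lam, cmul_eq, hA.mul_lam, hA.lam_inv_cancel]

/-- Two elements of a skew brace commute when both operations agree on them in either order. -/
structure BraceCommute (a b : A) : Prop where
  comm : a * b = b * a
  lam_left : lam a b = b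
  lam_right : lam b a = a

theorem BraceCommute.symm {a b : A} (h : BraceCommute a b) : BraceCommute b a :=
  ⟨h.comm.symm, h.lam_right, h.lam_left⟩

theorem BraceCommute.one_right (a : A) : BraceCommute a 1 :=
  ⟨by simp, lam_one a, one_lam a⟩

theorem BraceCommute.mul_right (hA : IsSymmetric A) {a b c : A} (hb : BraceCommute a b)
    (hc : BraceCommute a c) : BraceCommute a (b * c) where
  comm := by rw [← mul_assoc, hb.comm, mul_assoc, hc.comm, mul_assoc]
  lam_left := by rw [lam_mul, hb.lam_left, hc.lam_left]
  lam_right := by rw [hA.mul_lam, hb.lam_right, hc.lam_right]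

theorem BraceCommute.inv_right (hA : IsSymmetric A) {a b : A} (h : BraceCommute a b) :
    BraceCommute a b⁻¹ where
  comm := (Commute.inv_right (show Commute a b from h.comm)).eq
  lam_left := by rw [lam_inv, h.lam_left]
  lam_right := by
    have := hA.inv_lam_cancel b a
    rwa [h.lam_right] at this

/-- The annihilator of a skew brace, in terms of commuting elements. -/
def annihilator (A : Type u) [SkewBrace A] : Set A := {z | ∀ b, BraceCommute z b}

/-- All three brace commutators of `c` and `w` lie in `S`. -/
def CommutatorsIn (S : Set A) (c w : A) : Prop := bstar c w ∈ S ∧ bstar w c ∈ S ∧ dcomm c w ∈ S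

theorem bstar_eq_one_iff {a b : A} : bstar a b = 1 ↔ lam a b = b := by
  rw [bstar_def, mul_inv_eq_one]

theorem dcomm_eq_one_iff {a b : A} : dcomm a b = 1 ↔ a * b = b * a := by
  rw [dcomm_def, mul_inv_eq_one, mul_inv_eq_iff_eq_mul]

theorem braceCommute_iff {a b : A} :
    BraceCommute a b ↔ bstar a b = 1 ∧ bstar b a = 1 ∧ dcomm a b = 1 := by
  rw [bstar_eq_one_iff, bstar_eq_one_iff, dcomm_eq_one_iff]
  exact ⟨fun h => ⟨h.2, h.3, h.1⟩, fun h => ⟨h.2.2, h.1, h.2.1⟩⟩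

theorem dcomm_inv (a b : A) : (dcomm a b)⁻¹ = dcomm b a := by
  simp only [dcomm_def]; group

section Hom

variable {B : Type v} [SkewBrace B] {f : A → B}

theorem IsBraceHom.map_mul (hf : IsBraceHom f) (x y : A) : f (x * y) = f x * f y :=
  hf.map_dmul x y

theorem IsBraceHom.map_one (hf : IsBraceHom f) : f 1 = 1 :=
  (MonoidHom.mk' f hf.map_mul).map_one

theorem IsBraceHom.map_inv (hf : IsBraceHom f) (x : A) : f x⁻¹ = (f x)⁻¹ :=
  (MonoidHom.mk' f hf.map_mul).map_inv x

theorem IsBraceHom.map_cinv (hf : IsBraceHom f) (x : A) : f (cinv x) = cinv (f x) := by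
  have h : cmul (f (cinv x)) (f x) = ident := by
    rw [← hf.map_cmul, cinv_cmul]; exact hf.map_one
  rw [← cmul_ident (f (cinv x)), ← cmul_cinv (f x), ← cmul_assoc, h, ident_cmul]

theorem IsBraceHom.map_lam (hf : IsBraceHom f) (x y : A) : f (lam x y) = lam (f x) (f y) := by
  rw [lam_def, hf.map_mul, hf.map_inv, hf.map_cmul, lam_def]

theorem IsBraceHom.map_bstar (hf : IsBraceHom f) (x y : A) :
    f (bstar x y) = bstar (f x) (f y) := by
  rw [bstar_def, hf.map_mul, hf.map_inv, hf.map_lam, bstar_def]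

theorem IsBraceHom.map_dcomm (hf : IsBraceHom f) (x y : A) :
    f (dcomm x y) = dcomm (f x) (f y) := by
  simp only [dcomm_def, hf.map_mul, hf.map_inv]

theorem IsBraceHom.map_evalX (hf : IsBraceHom f) (e : BWord) (x y : A) :
    f (evalX e x y) = evalX e (f x) (f y) := by
  cases e <;> simp only [evalX, hf.map_dcomm, hf.map_bstar]

theorem IsBraceHom.map_evalW (hf : IsBraceHom f) (e : ℕ → BWord) (a : ℕ → A) (n : ℕ) :
    f (evalW e a n) = evalW e (fun i => f (a i)) n := by
  induction n generalizing e a with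
  | zero => rfl
  | succ n ih => simp only [evalW, hf.map_evalX, ih]

theorem IsSymmetric.of_surjective (hA : IsSymmetric A) (hf : IsBraceHom f)
    (hs : Function.Surjective f) : IsSymmetric B := by
  intro a b c
  obtain ⟨a, rfl⟩ := hs a
  obtain ⟨b, rfl⟩ := hs b
  obtain ⟨c, rfl⟩ := hs c
  simp only [← hf.map_cinv, ← hf.map_cmul, ← hf.map_dmul]
  rw [hA]

theorem IsBraceHom.eq_iff {S : Set A} (hf : IsBraceHom f) (hk : ∀ a, f a = 1 ↔ a ∈ S) {x y : A} :
    f x = f y ↔ x * y⁻¹ ∈ S := by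
  rw [← hk, hf.map_mul, hf.map_inv, mul_inv_eq_one]

theorem IsBraceHom.cosetRel_iff {S : Set A} (hf : IsBraceHom f) (hk : ∀ a, f a = 1 ↔ a ∈ S)
    {x y : A} : cosetRel S x y ↔ f y = f x := by
  rw [hf.eq_iff hk]
  constructor
  · rintro ⟨c, hc, rfl⟩
    rwa [dmul_eq_mul, mul_inv_cancel_right]
  · intro h
    exact ⟨_, h, by rw [dmul_eq_mul, inv_mul_cancel_right]⟩

theorem IsBraceHom.commutatorsIn_iff {S : Set A} (hf : IsBraceHom f)
    (hk : ∀ a, f a = 1 ↔ a ∈ S) {c w : A} :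
    CommutatorsIn S c w ↔ BraceCommute (f c) (f w) := by
  rw [braceCommute_iff, ← hf.map_bstar, ← hf.map_bstar, ← hf.map_dcomm, hk, hk, hk]
  rfl

theorem IsBraceHom.mem_annS_succ_iff {n : ℕ} (hf : IsBraceHom f) (hs : Function.Surjective f)
    (hk : ∀ a, f a = 1 ↔ a ∈ AnnS A n) {c : A} :
    c ∈ AnnS A (n + 1) ↔ f c ∈ annihilator B := by
  constructor
  · intro h b
    obtain ⟨b, rfl⟩ := hs b
    exact (hf.commutatorsIn_iff hk).1 (h b)
  · intro h b
    exact (hf.commutatorsIn_iff hk).2 (h (f b))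

end Hom

section AnnihilatorQuotient

theorem one_mem_annihilator : (1 : A) ∈ annihilator A := fun b => (BraceCommute.one_right b).symm

theorem mul_mem_annihilator (hA : IsSymmetric A) {x y : A} (hx : x ∈ annihilator A)
    (hy : y ∈ annihilator A) : x * y ∈ annihilator A :=
  fun b => ((hx b).symm.mul_right hA (hy b).symm).symm

theorem inv_mem_annihilator (hA : IsSymmetric A) {x : A} (hx : x ∈ annihilator A) :
    x⁻¹ ∈ annihilator A :=
  fun b => ((hx b).symm.inv_right hA).symm

/-- The congruence modulo the annihilator of a symmetric skew brace. -/
def annihilatorSetoid (hA : IsSymmetric A) : Setoid A where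
  r x y := ∃ z ∈ annihilator A, x = z * y
  iseqv :=
    { refl := fun x => ⟨1, one_mem_annihilator, (one_mul x).symm⟩
      symm := by
        rintro x y ⟨z, hz, rfl⟩
        exact ⟨z⁻¹, inv_mem_annihilator hA hz, by rw [inv_mul_cancel_left]⟩
      trans := by
        rintro x y w ⟨z, hz, rfl⟩ ⟨z', hz', rfl⟩
        exact ⟨z * z', mul_mem_annihilator hA hz hz', by rw [mul_assoc]⟩ }

theorem lam_mul_annihilator (hA : IsSymmetric A) {z z' : A} (hz : z ∈ annihilator A)
    (hz' : z' ∈ annihilator A) (x y : A) : lam (z * x) (z' * y) = z' * lam x y := by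
  rw [hA.mul_lam, (hz _).lam_left, lam_mul, (hz' _).lam_right]

theorem mul_mul_annihilator {z z' : A} (hz' : z' ∈ annihilator A) (x y : A) :
    (z * x) * (z' * y) = (z * z') * (x * y) := by
  rw [mul_assoc, ← mul_assoc x, ← (hz' x).comm]
  simp only [mul_assoc]

/-- The quotient of a symmetric skew brace by its annihilator. -/
@[reducible] def annihilatorQuotient (hA : IsSymmetric A) :
    SkewBrace (Quotient (annihilatorSetoid hA)) where
  dmul := Quotient.map₂ dmul (by
    rintro _ x ⟨z, hz, rfl⟩ _ y ⟨z', hz', rfl⟩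
    exact ⟨z * z', mul_mem_annihilator hA hz hz', mul_mul_annihilator hz' x y⟩)
  ident := Quotient.mk _ ident
  dinv := Quotient.map dinv (by
    rintro _ x ⟨z, hz, rfl⟩
    refine ⟨z⁻¹, inv_mem_annihilator hA hz, ?_⟩
    rw [dinv_eq_inv, dinv_eq_inv, (hz x).comm, mul_inv_rev])
  cmul := Quotient.map₂ cmul (by
    rintro _ x ⟨z, hz, rfl⟩ _ y ⟨z', hz', rfl⟩
    refine ⟨z * z', mul_mem_annihilator hA hz hz', ?_⟩
    rw [cmul_eq, cmul_eq, lam_mul_annihilator hA hz hz', mul_mul_annihilator hz'])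
  cinv := Quotient.map cinv (by
    rintro _ x ⟨z, hz, rfl⟩
    refine ⟨z⁻¹, inv_mem_annihilator hA hz, ?_⟩
    have hz' := inv_mem_annihilator hA hz
    have h : cmul (z * x) (z⁻¹ * cinv x) = ident := by
      rw [cmul_eq, lam_mul_annihilator hA hz hz', mul_mul_annihilator hz', mul_inv_cancel,
        one_mul, ← cmul_eq, cmul_cinv]
    rw [← cmul_ident (cinv (z * x)), ← h, ← cmul_assoc, cinv_cmul, ident_cmul])
  dmul_assoc := by
    rintro ⟨a⟩ ⟨b⟩ ⟨c⟩
    exact congrArg (Quotient.mk _) (dmul_assoc a b c)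
  ident_dmul := by
    rintro ⟨a⟩
    exact congrArg (Quotient.mk _) (ident_dmul a)
  dmul_ident := by
    rintro ⟨a⟩
    exact congrArg (Quotient.mk _) (dmul_ident a)
  dinv_dmul := by
    rintro ⟨a⟩
    exact congrArg (Quotient.mk _) (dinv_dmul a)
  dmul_dinv := by
    rintro ⟨a⟩
    exact congrArg (Quotient.mk _) (dmul_dinv a)
  cmul_assoc := by
    rintro ⟨a⟩ ⟨b⟩ ⟨c⟩
    exact congrArg (Quotient.mk _) (cmul_assoc a b c)
  ident_cmul := by
    rintro ⟨a⟩
    exact congrArg (Quotient.mk _) (ident_cmul a)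
  cmul_ident := by
    rintro ⟨a⟩
    exact congrArg (Quotient.mk _) (cmul_ident a)
  cinv_cmul := by
    rintro ⟨a⟩
    exact congrArg (Quotient.mk _) (cinv_cmul a)
  cmul_cinv := by
    rintro ⟨a⟩
    exact congrArg (Quotient.mk _) (cmul_cinv a)
  compat := by
    rintro ⟨a⟩ ⟨b⟩ ⟨c⟩
    exact congrArg (Quotient.mk _) (compat a b c)

theorem exists_annihilator_quotient (hA : IsSymmetric A) :
    ∃ (Q : Type u) (_ : SkewBrace Q) (p : A → Q), IsBraceHom p ∧ Function.Surjective p ∧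
      ∀ a, p a = 1 ↔ a ∈ annihilator A := by
  let := annihilatorQuotient hA
  refine ⟨Quotient (annihilatorSetoid hA), this, Quotient.mk _, ⟨fun _ _ => rfl, fun _ _ => rfl⟩,
    Quotient.mk_surjective, fun a => ?_⟩
  refine Quotient.eq.trans ⟨?_, fun h => ⟨a, h, (mul_one a).symm⟩⟩
  rintro ⟨z, hz, rfl⟩
  rwa [ident_eq_one, mul_one]

theorem exists_annS_quotient (hA : IsSymmetric A) (n : ℕ) :
    ∃ (Q : Type u) (_ : SkewBrace Q) (p : A → Q), IsBraceHom p ∧ Function.Surjective p ∧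
      ∀ a, p a = 1 ↔ a ∈ AnnS A n := by
  induction n with
  | zero => exact ⟨A, _, id, ⟨fun _ _ => rfl, fun _ _ => rfl⟩, Function.surjective_id,
      fun a => Iff.rfl⟩
  | succ n ih =>
    obtain ⟨Q, _, p, hp, hs, hk⟩ := ih
    obtain ⟨R, _, q, hq, hqs, hqk⟩ := exists_annihilator_quotient (hA.of_surjective hp hs)
    refine ⟨R, _, q ∘ p, ⟨fun x y => ?_, fun x y => ?_⟩, hqs.comp hs, fun a => ?_⟩
    · simp only [Function.comp_apply, hp.map_dmul, hq.map_dmul]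
    · simp only [Function.comp_apply, hp.map_cmul, hq.map_cmul]
    · rw [Function.comp_apply, hqk, hp.mem_annS_succ_iff hs hk]

end AnnihilatorQuotient

section ThreeSubgroups

/-- Two automorphisms that move `c` only by mutually fixed factors, one of them central,
commute at `c`. -/
theorem commute_at_of_fixed {G : Type*} [Group G] {α ω : G → G}
    (hα : ∀ x y, α (x * y) = α x * α y) (hω : ∀ x y, ω (x * y) = ω x * ω y) {c y z : G}
    (hαc : α c = y * c) (hωc : ω c = z * c) (hy : ω y = y) (hz : α z = z)
    (hyz : y * z = z * y) : α (ω c) = ω (α c) := by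
  rw [hωc, hα, hz, hαc, hω, hy, hωc, ← mul_assoc, ← mul_assoc, hyz]

variable {Y W : Set A} {c : A}

theorem conj_eq_of_dcomm (a c : A) : a * c * a⁻¹ = (dcomm c a)⁻¹ * c := by
  rw [dcomm_def]; group

theorem lam_eq_bstar_mul (a c : A) : lam a c = bstar a c * c := by
  rw [bstar_def, inv_mul_cancel_right]

theorem conj_mul (a x y : A) : a * (x * y) * a⁻¹ = a * x * a⁻¹ * (a * y * a⁻¹) := by
  group

theorem conj_eq_of_comm {a y : A} (h : a * y = y * a) : a * y * a⁻¹ = y := by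
  rw [h, mul_inv_cancel_right]

theorem conj_conj_comm (hA : IsSymmetric A) (hYW : ∀ y ∈ Y, ∀ w ∈ W, BraceCommute y w)
    (hY : ∀ a, CommutatorsIn Y c a) (hZ : ∀ w ∈ W, CommutatorsIn (annihilator A) c w)
    (a : A) {w : A} (hw : w ∈ W) :
    a * (w * c * w⁻¹) * a⁻¹ = w * (a * c * a⁻¹) * w⁻¹ := by
  have hy := ((hYW _ (hY a).2.2 w hw).symm.inv_right hA)
  have hz := inv_mem_annihilator hA (hZ w hw).2.2
  exact commute_at_of_fixed (α := fun x => a * x * a⁻¹) (ω := fun x => w * x * w⁻¹)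
    (conj_mul a) (conj_mul w) (conj_eq_of_dcomm a c) (conj_eq_of_dcomm w c)
    (conj_eq_of_comm hy.comm) (conj_eq_of_comm (hz a).comm.symm) (hz _).comm.symm

theorem lam_lam_comm (hYW : ∀ y ∈ Y, ∀ w ∈ W, BraceCommute y w)
    (hY : ∀ a, CommutatorsIn Y c a) (hZ : ∀ w ∈ W, CommutatorsIn (annihilator A) c w)
    (a : A) {w : A} (hw : w ∈ W) : lam a (lam w c) = lam w (lam a c) :=
  commute_at_of_fixed (lam_mul a) (lam_mul w) (lam_eq_bstar_mul a c) (lam_eq_bstar_mul w c)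
    (hYW _ (hY a).2.1 w hw).lam_right ((hZ w hw).2.1 a).lam_right ((hZ w hw).2.1 _).comm.symm

theorem lam_conj_comm (hA : IsSymmetric A) (hYW : ∀ y ∈ Y, ∀ w ∈ W, BraceCommute y w)
    (hY : ∀ a, CommutatorsIn Y c a) (hZ : ∀ w ∈ W, CommutatorsIn (annihilator A) c w)
    (a : A) {w : A} (hw : w ∈ W) : lam a (w * c * w⁻¹) = w * lam a c * w⁻¹ := by
  have hz := inv_mem_annihilator hA (hZ w hw).2.2
  exact commute_at_of_fixed (ω := fun x => w * x * w⁻¹) (lam_mul a) (conj_mul w)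
    (lam_eq_bstar_mul a c) (conj_eq_of_dcomm w c)
    (conj_eq_of_comm (hYW _ (hY a).2.1 w hw).comm.symm) (hz a).lam_right (hz _).comm.symm

theorem conj_lam_comm (hA : IsSymmetric A) (hYW : ∀ y ∈ Y, ∀ w ∈ W, BraceCommute y w)
    (hY : ∀ a, CommutatorsIn Y c a) (hZ : ∀ w ∈ W, CommutatorsIn (annihilator A) c w)
    (a : A) {w : A} (hw : w ∈ W) : a * lam w c * a⁻¹ = lam w (a * c * a⁻¹) := by
  have hy := ((hYW _ (hY a).2.2 w hw).symm.inv_right hA)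
  have hz := (hZ w hw).2.1
  exact commute_at_of_fixed (α := fun x => a * x * a⁻¹) (conj_mul a) (lam_mul w)
    (conj_eq_of_dcomm a c) (lam_eq_bstar_mul w c) hy.lam_left
    (conj_eq_of_comm (hz a).comm.symm) (hz _).comm.symm

theorem IsSymmetric.lam_lam_swap (hA : IsSymmetric A) (c a x : A) :
    lam c (lam a x) = lam a (lam c (lam (dcomm c a)⁻¹ x)) := by
  rw [← hA.mul_lam, ← hA.mul_lam, ← hA.mul_lam]
  congr 1
  rw [dcomm_def]; group

theorem braceCommute_dcomm (hA : IsSymmetric A) (hYW : ∀ y ∈ Y, ∀ w ∈ W, BraceCommute y w)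
    (hY : ∀ a, CommutatorsIn Y c a) (hZ : ∀ w ∈ W, CommutatorsIn (annihilator A) c w)
    (hWinv : ∀ w ∈ W, w⁻¹ ∈ W) (a : A) {w : A} (hw : w ∈ W) (hW : dcomm a w ∈ W) :
    BraceCommute c (dcomm a w) where
  comm := by
    have h := conj_conj_comm hA hYW hY hZ a⁻¹ (hWinv w hw)
    have h2 : c = dcomm a w * c * (dcomm a w)⁻¹ := by
      have h3 := congrArg (fun x => a * (w * x * w⁻¹) * a⁻¹) h
      have h4 : a * (w * (a⁻¹ * (w⁻¹ * c * w⁻¹⁻¹) * a⁻¹⁻¹) * w⁻¹) * a⁻¹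
          = dcomm a w * c * (dcomm a w)⁻¹ := by
        rw [dcomm_def]; group
      have h5 : a * (w * (w⁻¹ * (a⁻¹ * c * a⁻¹⁻¹) * w⁻¹⁻¹) * w⁻¹) * a⁻¹ = c := by group
      exact h5.symm.trans (h3.symm.trans h4)
    exact eq_mul_inv_iff_mul_eq.1 h2
  lam_left := by
    have hy := hYW _ (hY a).1
    have hz := (hZ w hw).1
    rw [dcomm_def, lam_mul, lam_mul, lam_mul, lam_inv, lam_inv, lam_eq_bstar_mul c a,
      lam_eq_bstar_mul c w]
    generalize bstar c a = y at hy
    generalize bstar c w = z at hz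
    have h1 := (hy w hw).comm
    have h2 := (hy _ hW).comm
    have h3 : y * a * (z * w) * (y * a)⁻¹ * (z * w)⁻¹ = y * a * w * a⁻¹ * y⁻¹ * w⁻¹ := by
      have : z * w * (y * a)⁻¹ * (z * w)⁻¹ = w * (y * a)⁻¹ * w⁻¹ := by
        have hc := (hz (w * (y * a)⁻¹ * w⁻¹)).comm
        calc _ = z * (w * (y * a)⁻¹ * w⁻¹) * z⁻¹ := by group
          _ = _ := conj_eq_of_comm hc
      calc _ = y * a * (z * w * (y * a)⁻¹ * (z * w)⁻¹) := by group
        _ = _ := by rw [this]; group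
    have h4 : y⁻¹ * w⁻¹ = w⁻¹ * y⁻¹ := by rw [← mul_inv_rev, ← mul_inv_rev, h1]
    rw [h3, mul_assoc, h4]
    calc _ = y * dcomm a w * y⁻¹ := by rw [dcomm_def]; group
      _ = _ := conj_eq_of_comm h2
  lam_right := by
    simp only [dcomm_def, hA.mul_lam]
    rw [← lam_lam_comm hYW hY hZ a hw, hA.inv_lam_cancel, hA.inv_lam_cancel]

theorem braceCommute_bstar_left (hA : IsSymmetric A) (hYW : ∀ y ∈ Y, ∀ w ∈ W, BraceCommute y w)
    (hY : ∀ a, CommutatorsIn Y c a) (hZ : ∀ w ∈ W, CommutatorsIn (annihilator A) c w)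
    (hWinv : ∀ w ∈ W, w⁻¹ ∈ W) (a : A) {w : A} (hw : w ∈ W) :
    BraceCommute c (bstar a w) where
  comm := by
    have h := lam_conj_comm hA hYW hY hZ a⁻¹ (hWinv w hw)
    have h2 := congrArg (lam a) h
    rw [hA.lam_inv_cancel, lam_mul, lam_mul, hA.lam_inv_cancel, inv_inv, lam_inv] at h2
    rw [bstar_def]
    calc c * (lam a w * w⁻¹) = lam a w * ((lam a w)⁻¹ * c * lam a w) * w⁻¹ := by group
      _ = lam a w * w⁻¹ * c := by rw [← h2]; group
  lam_left := by
    have hz := (hZ w hw).1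
    have h : lam c (lam a w) = bstar c w * lam a w := by
      rw [hA.lam_lam_swap, ((hYW _ (hY a).2.2 w hw).symm.inv_right hA).symm.lam_left,
        lam_eq_bstar_mul c w, lam_mul, (hz a).lam_right]
    rw [bstar_def, lam_mul, h, lam_inv, lam_eq_bstar_mul c w, mul_inv_rev, ← mul_assoc,
      mul_assoc (bstar c w)]
    exact conj_eq_of_comm (hz _).comm
  lam_right := by
    rw [bstar_def, hA.mul_lam, hA.lam_lam, ← lam_lam_comm hYW hY hZ a⁻¹ hw, hA.lam_inv_cancel,
      hA.inv_lam_cancel]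

theorem braceCommute_bstar_right (hA : IsSymmetric A) (hYW : ∀ y ∈ Y, ∀ w ∈ W, BraceCommute y w)
    (hY : ∀ a, CommutatorsIn Y c a) (hZ : ∀ w ∈ W, CommutatorsIn (annihilator A) c w)
    (hWinv : ∀ w ∈ W, w⁻¹ ∈ W) (a : A) {w : A} (hw : w ∈ W) (hW : bstar w a ∈ W) :
    BraceCommute c (bstar w a) where
  comm := by
    have h := conj_lam_comm hA hYW hY hZ a⁻¹ (hWinv w hw)
    have h2 := congrArg (lam w) h
    rw [hA.lam_inv_cancel, lam_mul, lam_mul, hA.lam_inv_cancel, inv_inv, lam_inv] at h2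
    rw [bstar_def]
    calc c * (lam w a * a⁻¹) = lam w a * ((lam w a)⁻¹ * c * lam w a) * a⁻¹ := by group
      _ = lam w a * a⁻¹ * c := by rw [h2]; group
  lam_left := by
    have hy := hYW _ (hY a).1
    have hz := inv_mem_annihilator hA (hZ w hw).2.2
    have h : lam c (lam w a) = bstar c a * lam w a := by
      rw [hA.lam_lam_swap, (hz a).lam_left, lam_eq_bstar_mul c a, lam_mul, (hy w hw).lam_right]
    rw [bstar_def, lam_mul, h, lam_inv, lam_eq_bstar_mul c a, mul_inv_rev, ← mul_assoc,
      mul_assoc (bstar c a)]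
    exact conj_eq_of_comm (hy _ hW).comm
  lam_right := by
    rw [bstar_def, hA.mul_lam, hA.lam_lam, lam_lam_comm hYW hY hZ a (hWinv w hw),
      hA.lam_inv_cancel, hA.inv_lam_cancel]

end ThreeSubgroups

section LowerCentral

theorem gamma_one_mem (n : ℕ) : (1 : A) ∈ Gamma A n := by
  match n with
  | 0 | 1 => trivial
  | n + 2 => exact dclosure.one

theorem gamma_mul_mem {n : ℕ} {x y : A} (hx : x ∈ Gamma A n) (hy : y ∈ Gamma A n) :
    x * y ∈ Gamma A n := by
  match n with
  | 0 | 1 => trivial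
  | n + 2 => exact dclosure.mul hx hy

theorem gamma_inv_mem {n : ℕ} {x : A} (hx : x ∈ Gamma A n) : x⁻¹ ∈ Gamma A n := by
  match n with
  | 0 | 1 => trivial
  | n + 2 => exact dclosure.inv hx

theorem bstar_left_mem_gamma {n : ℕ} (a : A) {w : A} (hw : w ∈ Gamma A (n + 1)) :
    bstar a w ∈ Gamma A (n + 2) :=
  dclosure.mem (Or.inl (Or.inl ⟨a, trivial, w, hw, rfl⟩))

theorem bstar_right_mem_gamma {n : ℕ} (a : A) {w : A} (hw : w ∈ Gamma A (n + 1)) :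
    bstar w a ∈ Gamma A (n + 2) :=
  dclosure.mem (Or.inl (Or.inr ⟨w, hw, a, trivial, rfl⟩))

theorem dcomm_mem_gamma {n : ℕ} (a : A) {w : A} (hw : w ∈ Gamma A (n + 1)) :
    dcomm a w ∈ Gamma A (n + 2) :=
  dclosure.mem (Or.inr ⟨a, trivial, w, hw, rfl⟩)

theorem evalX_mem_gamma {n : ℕ} (e : BWord) (a : A) {w : A} (hw : w ∈ Gamma A (n + 1)) :
    evalX e a w ∈ Gamma A (n + 2) := by
  cases e with
  | g => exact dcomm_mem_gamma a hw
  | gbar =>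
    have h := gamma_inv_mem (dcomm_mem_gamma a hw)
    rwa [dcomm_inv] at h
  | s => exact bstar_left_mem_gamma a hw
  | sbar => exact bstar_right_mem_gamma a hw

theorem gamma_succ_subset (n : ℕ) : Gamma A (n + 1) ⊆ Gamma A n := by
  match n with
  | 0 | 1 => exact fun _ _ => trivial
  | n + 2 =>
    intro x hx
    induction hx with
    | mem h =>
      rcases h with (⟨a, -, w, hw, rfl⟩ | ⟨w, hw, a, -, rfl⟩) | ⟨a, -, w, hw, rfl⟩
      · exact bstar_left_mem_gamma a (gamma_succ_subset (n + 1) hw)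
      · exact bstar_right_mem_gamma a (gamma_succ_subset (n + 1) hw)
      · exact dcomm_mem_gamma a (gamma_succ_subset (n + 1) hw)
    | one => exact gamma_one_mem _
    | mul _ _ hx hy => exact gamma_mul_mem hx hy
    | inv _ hx => exact gamma_inv_mem hx

theorem gamma_antitone : Antitone (Gamma A) := antitone_nat_of_succ_le gamma_succ_subset

theorem evalW_mem_gamma (e : ℕ → BWord) (a : ℕ → A) (n : ℕ) :
    evalW e a n ∈ Gamma A (n + 1) := by
  induction n generalizing e a with
  | zero => trivial
  | succ n ih => exact evalX_mem_gamma _ _ (ih _ _)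

theorem asub_subset_gamma (n : ℕ) : Asub A n ⊆ Gamma A (n + 1) := by
  intro x hx
  induction hx with
  | mem h =>
    obtain ⟨s, hs, e, a, rfl⟩ := h
    exact gamma_antitone (Nat.succ_le_succ hs) (evalW_mem_gamma e a s)
  | one => exact gamma_one_mem _
  | mul _ _ hx hy => exact gamma_mul_mem hx hy
  | inv _ hx => exact gamma_inv_mem hx

theorem evalW_mem_asub (e : ℕ → BWord) (a : ℕ → A) (n : ℕ) : evalW e a n ∈ Asub A n :=
  dclosure.mem ⟨n, le_rfl, e, a, rfl⟩

/-- `Asub A n` as a subgroup of `(A,·)`. -/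
def asubSubgroup (A : Type u) [SkewBrace A] (n : ℕ) : Subgroup A where
  carrier := Asub A n
  one_mem' := dclosure.one
  mul_mem' := dclosure.mul
  inv_mem' := dclosure.inv

theorem evalX_evalW_mem_asub {n s : ℕ} (hs : n ≤ s + 1) (x : BWord) (c : A) (e : ℕ → BWord)
    (a : ℕ → A) : evalX x c (evalW e a s) ∈ asubSubgroup A n :=
  dclosure.mem ⟨s + 1, hs, fun i => Nat.casesOn i x e, fun i => Nat.casesOn i c a, rfl⟩

theorem conj_mem_asub {n : ℕ} (c : A) {x : A} (hx : x ∈ asubSubgroup A n) :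
    c * x * c⁻¹ ∈ asubSubgroup A n := by
  change dclosure _ x at hx
  induction hx with
  | @mem x h =>
    have h0 : x ∈ asubSubgroup A n := dclosure.mem h
    obtain ⟨s, hs, e, a, rfl⟩ := h
    have h1 := evalX_evalW_mem_asub (hs.trans s.le_succ) BWord.g c e a
    have h2 := mul_mem h1 h0
    rwa [evalX, dcomm_def, inv_mul_cancel_right] at h2
  | one => rw [ident_eq_one, mul_one, mul_inv_cancel]; exact one_mem _
  | mul _ _ hx hy => rw [dmul_eq_mul, conj_mul]; exact mul_mem hx hy
  | @inv x _ hx => rw [dinv_eq_inv, ← conj_inv]; exact inv_mem hx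

theorem lam_mem_asub {n : ℕ} (c : A) {x : A} (hx : x ∈ asubSubgroup A n) :
    lam c x ∈ asubSubgroup A n := by
  change dclosure _ x at hx
  induction hx with
  | @mem x h =>
    have h0 : x ∈ asubSubgroup A n := dclosure.mem h
    obtain ⟨s, hs, e, a, rfl⟩ := h
    rw [lam_eq_bstar_mul]
    exact mul_mem (evalX_evalW_mem_asub (hs.trans s.le_succ) BWord.s c e a) h0
  | one => rw [ident_eq_one, lam_one]; exact one_mem _
  | mul _ _ hx hy => rw [dmul_eq_mul, lam_mul]; exact mul_mem hx hy
  | inv _ hx => rw [dinv_eq_inv, lam_inv]; exact inv_mem hx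

theorem commutators_mem_asub_succ (hA : IsSymmetric A) {n : ℕ} {x : A} (hx : x ∈ Asub A n)
    (c : A) : CommutatorsIn (asubSubgroup A (n + 1) : Set A) c x := by
  induction hx generalizing c with
  | mem h =>
    obtain ⟨s, hs, e, a, rfl⟩ := h
    have hs := Nat.succ_le_succ hs
    exact ⟨evalX_evalW_mem_asub hs BWord.s c e a, evalX_evalW_mem_asub hs BWord.sbar c e a,
      evalX_evalW_mem_asub hs BWord.g c e a⟩
  | one =>
    have h := braceCommute_iff.1 (BraceCommute.one_right c)
    rw [ident_eq_one, CommutatorsIn, h.1, h.2.1, h.2.2]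
    exact ⟨one_mem _, one_mem _, one_mem _⟩
  | @mul x y _ _ hx hy =>
    rw [dmul_eq_mul]
    refine ⟨?_, ?_, ?_⟩
    · have h : bstar c (x * y) = bstar c x * (x * bstar c y * x⁻¹) := by
        simp only [bstar_def, lam_mul]; group
      rw [h]
      exact mul_mem (hx c).1 (conj_mem_asub x (hy c).1)
    · have h : bstar (x * y) c = lam y (bstar x c) * bstar y c := by
        simp only [bstar_def, lam_mul, hA.mul_lam, lam_inv]; group
      rw [h]
      exact mul_mem (lam_mem_asub y (hx c).2.1) (hy c).2.1
    · have h : dcomm c (x * y) = dcomm c x * (x * dcomm c y * x⁻¹) := by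
        simp only [dcomm_def]; group
      rw [h]
      exact mul_mem (hx c).2.2 (conj_mem_asub x (hy c).2.2)
  | @inv x _ hx =>
    rw [dinv_eq_inv]
    refine ⟨?_, ?_, ?_⟩
    · have h : bstar c x⁻¹ = x⁻¹ * (bstar c x)⁻¹ * x⁻¹⁻¹ := by
        simp only [bstar_def, lam_inv]; group
      rw [h]
      exact conj_mem_asub _ (inv_mem (hx c).1)
    · have h : bstar x⁻¹ c = lam x⁻¹ (bstar x c)⁻¹ := by
        rw [bstar_def, bstar_def, mul_inv_rev, inv_inv, lam_mul, lam_inv, hA.inv_lam_cancel]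
      rw [h]
      exact lam_mem_asub _ (inv_mem (hx c).2.1)
    · have h : dcomm c x⁻¹ = x⁻¹ * (dcomm c x)⁻¹ * x⁻¹⁻¹ := by
        simp only [dcomm_def]; group
      rw [h]
      exact conj_mem_asub _ (inv_mem (hx c).2.2)

/-- In a symmetric skew brace, `A_{(n)} = Γ_{n+1}(A)`. -/
theorem IsSymmetric.asub_eq_gamma (hA : IsSymmetric A) (n : ℕ) : Asub A n = Gamma A (n + 1) := by
  refine Set.Subset.antisymm (asub_subset_gamma n) ?_
  induction n with
  | zero => exact fun x _ => dclosure.mem ⟨0, le_rfl, fun _ => BWord.g, fun _ => x, rfl⟩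
  | succ n ih =>
    intro x hx
    change x ∈ asubSubgroup A (n + 1)
    induction hx with
    | mem h =>
      rcases h with (⟨a, -, w, hw, rfl⟩ | ⟨w, hw, a, -, rfl⟩) | ⟨a, -, w, hw, rfl⟩
      · exact (commutators_mem_asub_succ hA (ih hw) a).1
      · exact (commutators_mem_asub_succ hA (ih hw) a).2.1
      · exact (commutators_mem_asub_succ hA (ih hw) a).2.2
    | one => exact one_mem _
    | mul _ _ hx hy => exact mul_mem hx hy
    | inv _ hx => exact inv_mem hx

end LowerCentral

section WellDefined

theorem annS_commutators_gamma (hA : IsSymmetric A) (i k : ℕ) {c w : A}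
    (hc : c ∈ AnnS A (k + i + 1)) (hw : w ∈ Gamma A (i + 1)) :
    CommutatorsIn (AnnS A k) c w := by
  induction i generalizing k c w with
  | zero => exact hc w
  | succ i ih =>
    obtain ⟨Q, _, p, hp, hs, hk⟩ := exists_annS_quotient hA k
    have hQ := hA.of_surjective hp hs
    have hYW : ∀ y ∈ p '' AnnS A (k + i + 1), ∀ w ∈ p '' Gamma A (i + 1), BraceCommute y w := by
      rintro _ ⟨y, hy, rfl⟩ _ ⟨w, hw, rfl⟩
      exact (hp.commutatorsIn_iff hk).1 (ih k hy hw)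
    have hY : ∀ a, CommutatorsIn (p '' AnnS A (k + i + 1)) (p c) a := by
      intro a
      obtain ⟨a, rfl⟩ := hs a
      have h := hc a
      exact ⟨⟨_, h.1, hp.map_bstar _ _⟩, ⟨_, h.2.1, hp.map_bstar _ _⟩,
        ⟨_, h.2.2, hp.map_dcomm _ _⟩⟩
    have hZ : ∀ w ∈ p '' Gamma A (i + 1), CommutatorsIn (annihilator Q) (p c) w := by
      rintro _ ⟨w, hw, rfl⟩
      have h := ih (k + 1) (c := c) (by rwa [add_right_comm k 1 i]) hw
      rw [CommutatorsIn, ← hp.map_bstar, ← hp.map_bstar, ← hp.map_dcomm,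
        ← hp.mem_annS_succ_iff hs hk, ← hp.mem_annS_succ_iff hs hk, ← hp.mem_annS_succ_iff hs hk]
      exact h
    have hWinv : ∀ w ∈ p '' Gamma A (i + 1), w⁻¹ ∈ p '' Gamma A (i + 1) := by
      rintro _ ⟨w, hw, rfl⟩
      exact ⟨w⁻¹, gamma_inv_mem hw, hp.map_inv w⟩
    rw [hp.commutatorsIn_iff hk]
    clear hc
    induction hw with
    | mem h =>
      rcases h with (⟨a, -, w, hw, rfl⟩ | ⟨w, hw, a, -, rfl⟩) | ⟨a, -, w, hw, rfl⟩
      · rw [hp.map_bstar]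
        exact braceCommute_bstar_left hQ hYW hY hZ hWinv _ ⟨w, hw, rfl⟩
      · have h := gamma_succ_subset _ (bstar_right_mem_gamma a hw)
        rw [hp.map_bstar]
        exact braceCommute_bstar_right hQ hYW hY hZ hWinv _ ⟨w, hw, rfl⟩
          ⟨_, h, hp.map_bstar _ _⟩
      · have h := gamma_succ_subset _ (dcomm_mem_gamma a hw)
        rw [hp.map_dcomm]
        exact braceCommute_dcomm hQ hYW hY hZ hWinv _ ⟨w, hw, rfl⟩ ⟨_, h, hp.map_dcomm _ _⟩
    | one => rw [ident_eq_one, hp.map_one]; exact BraceCommute.one_right _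
    | mul _ _ hx hy => rw [hp.map_dmul]; exact hx.mul_right hQ hy
    | inv _ hx => rw [dinv_eq_inv, hp.map_inv]; exact hx.inv_right hQ

theorem dcomm_mul_annihilator_right {z : A} (hz : z ∈ annihilator A) (a w : A) :
    dcomm a (z * w) = dcomm a w := by
  have h : a * (z * w) = z * (a * w) := by rw [← mul_assoc, ← (hz a).comm, mul_assoc]
  rw [dcomm_def, dcomm_def, h, mul_inv_rev]
  calc _ = z * (a * w * a⁻¹ * w⁻¹) * z⁻¹ := by group
    _ = _ := conj_eq_of_comm (hz _).comm

theorem evalX_mul_annihilator (hA : IsSymmetric A) {z : A} (hz : z ∈ annihilator A) (e : BWord)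
    (a w : A) : evalX e a (z * w) = evalX e a w := by
  cases e with
  | g => exact dcomm_mul_annihilator_right hz a w
  | gbar =>
    change dcomm (z * w) a = dcomm w a
    rw [← dcomm_inv, dcomm_mul_annihilator_right hz, dcomm_inv]
  | s =>
    change bstar a (z * w) = bstar a w
    rw [bstar_def, bstar_def, lam_mul, (hz a).lam_right, mul_inv_rev]
    calc _ = z * (lam a w * w⁻¹) * z⁻¹ := by group
      _ = _ := conj_eq_of_comm (hz _).comm
  | sbar =>
    change bstar (z * w) a = bstar w a
    rw [bstar_def, bstar_def, hA.mul_lam, (hz a).lam_left]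

theorem dcomm_mul_of_braceCommute {c a w : A} (hw : BraceCommute c w)
    (h : BraceCommute c (dcomm a w)) : dcomm (c * a) w = dcomm a w := by
  have h1 : c⁻¹ * w⁻¹ = w⁻¹ * c⁻¹ := by rw [← mul_inv_rev, ← mul_inv_rev, hw.comm]
  calc dcomm (c * a) w = c * (a * w * a⁻¹) * (c⁻¹ * w⁻¹) := by rw [dcomm_def]; group
    _ = c * dcomm a w * c⁻¹ := by rw [h1, dcomm_def]; group
    _ = dcomm a w := conj_eq_of_comm h.comm

theorem evalX_mul_of_braceCommute (hA : IsSymmetric A) {c a w : A} {e : BWord}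
    (hw : BraceCommute c w) (h : BraceCommute c (evalX e a w)) :
    evalX e (c * a) w = evalX e a w := by
  cases e with
  | g => exact dcomm_mul_of_braceCommute hw h
  | gbar =>
    have h' : BraceCommute c (dcomm w a)⁻¹ := h.inv_right hA
    rw [dcomm_inv] at h'
    change dcomm w (c * a) = dcomm w a
    rw [← dcomm_inv, dcomm_mul_of_braceCommute hw h', dcomm_inv]
  | s =>
    change bstar (c * a) w = bstar a w
    rw [bstar_def, bstar_def, hA.mul_lam, hw.lam_left]
  | sbar =>
    change bstar w (c * a) = bstar w a
    rw [bstar_def, lam_mul, hw.lam_right]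
    calc _ = c * (lam w a * a⁻¹) * c⁻¹ := by group
      _ = _ := conj_eq_of_comm h.comm

theorem evalW_cosetRel (hA : IsSymmetric A) (m k : ℕ) (e : ℕ → BWord) (a b : ℕ → A)
    (h : ∀ i ≤ m, cosetRel (AnnS A (k + m)) (a i) (b i)) :
    cosetRel (AnnS A k) (evalW e a m) (evalW e b m) := by
  induction m generalizing k e a b with
  | zero => exact h 0 le_rfl
  | succ m ih =>
    obtain ⟨z, hz, hzw⟩ := ih (k + 1) (fun i => e (i + 1)) (fun i => a (i + 1))
      (fun i => b (i + 1)) fun i hi => by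
        rw [add_right_comm k 1 m]; exact h (i + 1) (Nat.succ_le_succ hi)
    obtain ⟨c, hc, hca⟩ := h 0 (Nat.zero_le _)
    obtain ⟨Q, _, p, hp, hs, hk⟩ := exists_annS_quotient hA k
    have hQ := hA.of_surjective hp hs
    rw [hp.cosetRel_iff hk, evalW, evalW, hzw, hca]
    have hw := evalW_mem_gamma (fun i => e (i + 1)) (fun i => a (i + 1)) m
    have hew := gamma_succ_subset _ (evalX_mem_gamma (e 0) (a 0) hw)
    have hcw := (hp.commutatorsIn_iff hk).1 (annS_commutators_gamma hA m k hc hw)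
    have hcew := (hp.commutatorsIn_iff hk).1 (annS_commutators_gamma hA m k hc hew)
    rw [hp.map_evalX] at hcew
    rw [hp.map_evalX, hp.map_dmul, hp.map_dmul, dmul_eq_mul, dmul_eq_mul,
      evalX_mul_annihilator hQ ((hp.mem_annS_succ_iff hs hk).1 hz),
      evalX_mul_of_braceCommute hQ hcw hcew, hp.map_evalX]

/-- Symmetric skew braces lie in the class `I_n`. -/
theorem IsSymmetric.inClass (hA : IsSymmetric A) (n : ℕ) : InClass A n := by
  intro e a b h
  obtain ⟨c, hc, hca⟩ := evalW_cosetRel hA n 0 e a b (by rwa [zero_add])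
  rw [hca, show c = ident from hc, ident_dmul]

end WellDefined

section Isoclinism

variable {B : Type v} [SkewBrace B] {f : A → B}

theorem cosetRel_iff_mul_inv_mem {S : Set A} {x y : A} : cosetRel S x y ↔ y * x⁻¹ ∈ S := by
  constructor
  · rintro ⟨c, hc, rfl⟩
    rwa [dmul_eq_mul, mul_inv_cancel_right]
  · intro h
    exact ⟨_, h, by rw [dmul_eq_mul, inv_mul_cancel_right]⟩

theorem IsBraceHom.map_mem_annS (hf : IsBraceHom f) (hs : Function.Surjective f) {k : ℕ} {c : A}
    (hc : c ∈ AnnS A k) : f c ∈ AnnS B k := by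
  induction k generalizing c with
  | zero => rw [show c = 1 from hc, hf.map_one]; rfl
  | succ k ih =>
    intro b
    obtain ⟨b, rfl⟩ := hs b
    have h := hc b
    rw [← hf.map_bstar, ← hf.map_bstar, ← hf.map_dcomm]
    exact ⟨ih h.1, ih h.2.1, ih h.2.2⟩

theorem IsBraceHom.mem_annS_of_map_mem (hf : IsBraceHom f) {m k : ℕ} {c : A}
    (hk : ∀ x ∈ Gamma A (m + k + 1), f x = 1 → x = 1) (hc : c ∈ Gamma A (m + 1))
    (hfc : f c ∈ AnnS B k) : c ∈ AnnS A k := by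
  induction k generalizing m c with
  | zero => exact hk c hc hfc
  | succ k ih =>
    intro b
    have h := hfc (f b)
    rw [← hf.map_bstar, ← hf.map_bstar, ← hf.map_dcomm] at h
    have hk' : ∀ x ∈ Gamma A (m + 1 + k + 1), f x = 1 → x = 1 := by
      rwa [add_assoc m 1 k, add_comm 1 k]
    exact ⟨ih hk' (evalX_mem_gamma BWord.sbar b hc) h.1,
      ih hk' (evalX_mem_gamma BWord.s b hc) h.2.1,
      ih hk' (evalX_mem_gamma BWord.gbar b hc) h.2.2⟩

theorem IsBraceHom.image_asub (hf : IsBraceHom f) (hs : Function.Surjective f) (n : ℕ) :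
    f '' Asub A n = Asub B n := by
  apply Set.Subset.antisymm
  · rintro _ ⟨x, hx, rfl⟩
    induction hx with
    | mem h =>
      obtain ⟨s, hs, e, a, rfl⟩ := h
      exact dclosure.mem ⟨s, hs, e, fun i => f (a i), hf.map_evalW e a s⟩
    | one => rw [ident_eq_one, hf.map_one]; exact dclosure.one
    | mul _ _ hx hy => rw [hf.map_dmul]; exact dclosure.mul hx hy
    | inv _ hx => rw [dinv_eq_inv, hf.map_inv]; exact dclosure.inv hx
  · intro y hy
    induction hy with
    | mem h =>
      obtain ⟨s, hn, e, b, rfl⟩ := h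
      choose g hg using hs
      refine ⟨evalW e (fun i => g (b i)) s, dclosure.mem ⟨s, hn, e, _, rfl⟩, ?_⟩
      simp only [hf.map_evalW, hg]
    | one => exact ⟨1, dclosure.one, hf.map_one⟩
    | mul _ _ hx hy =>
      obtain ⟨x, hx, rfl⟩ := hx
      obtain ⟨y, hy, rfl⟩ := hy
      exact ⟨x * y, dclosure.mul hx hy, hf.map_mul x y⟩
    | inv _ hx =>
      obtain ⟨x, hx, rfl⟩ := hx
      exact ⟨x⁻¹, dclosure.inv hx, hf.map_inv x⟩

/-- A surjective homomorphism of symmetric skew braces that is injective on `Γ_{n+1}` is an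
`n`-isoclinism. -/
theorem IsBraceHom.isoclinicN (hA : IsSymmetric A) (hf : IsBraceHom f)
    (hs : Function.Surjective f) {n : ℕ} (hk : ∀ x ∈ Gamma A (n + 1), f x = 1 → x = 1) :
    IsoclinicN A B n := by
  have hB := hA.of_surjective hf hs
  have hrefl : ∀ b : B, cosetRel (AnnS B n) b b := fun b =>
    ⟨f 1, hf.map_mem_annS hs (by
      obtain ⟨Q, _, p, hp, -, hpk⟩ := exists_annS_quotient hA n
      exact (hpk 1).1 hp.map_one), by rw [hf.map_one]; exact (one_mul b).symm⟩
  refine ⟨f, f, ?_, fun b => ?_, fun a a' => ?_, fun a a' => ?_, fun x hx => ?_,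
    fun x hx y hy h => ?_, fun y hy => ?_, fun x _ y _ => hf.map_dmul x y,
    fun x _ y _ => hf.map_cmul x y, fun e a b h => ?_⟩
  · intro a a'
    rw [cosetRel_iff_mul_inv_mem, cosetRel_iff_mul_inv_mem, ← hf.map_inv, ← hf.map_mul]
    exact ⟨hf.map_mem_annS hs, hf.mem_annS_of_map_mem (m := 0) (by rwa [zero_add]) trivial⟩
  · obtain ⟨a, rfl⟩ := hs b
    exact ⟨a, hrefl _⟩
  · rw [hf.map_dmul]; exact hrefl _
  · rw [hf.map_cmul]; exact hrefl _
  · rw [← hf.image_asub hs]; exact ⟨x, hx, rfl⟩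
  · refine mul_inv_eq_one.1 (hk _ ?_ ?_)
    · exact gamma_mul_mem (asub_subset_gamma n hx) (gamma_inv_mem (asub_subset_gamma n hy))
    · rw [hf.map_mul, hf.map_inv, h, mul_inv_cancel]
  · rwa [← hf.image_asub hs] at hy
  · rw [hf.map_evalW]
    exact hB.inClass n e b _ h

theorem IsoclinicN.symm (hA : IsSymmetric A) (hB : IsSymmetric B) {n : ℕ}
    (h : IsoclinicN A B n) : IsoclinicN B A n := by
  obtain ⟨ξ, θ, h⟩ := h
  obtain ⟨Q, _, p, hp, -, hpk⟩ := exists_annS_quotient hB n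
  obtain ⟨P, _, q, hq, -, hqk⟩ := exists_annS_quotient hA n
  have hcos : ∀ {x y : B}, cosetRel (AnnS B n) x y ↔ p y = p x := hp.cosetRel_iff hpk
  have hcosA : ∀ {x y : A}, cosetRel (AnnS A n) x y ↔ q y = q x := hq.cosetRel_iff hqk
  have hresp := h.xi_resp
  have hsurj := h.xi_surj
  have hdmul := h.xi_dmul
  have hcmul := h.xi_cmul
  have hcompat := h.compat
  simp only [hcos, hcosA] at hresp hsurj hdmul hcmul hcompat
  choose η hη using hsurj
  have hθ : ∀ y, ∃ x, y ∈ Asub B n → x ∈ Asub A n ∧ θ x = y := by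
    intro y
    by_cases hy : y ∈ Asub B n
    · obtain ⟨x, hx⟩ := h.theta_surj y hy
      exact ⟨x, fun _ => hx⟩
    · exact ⟨1, fun h => absurd h hy⟩
  choose τ hτ using hθ
  refine ⟨η, τ, ?_, ?_, ?_, ?_, fun x hx => (hτ x hx).1, fun x hx y hy hxy => ?_, fun y hy => ?_,
    fun x hx y hy => ?_, fun x hx y hy => ?_, fun e a b hab => ?_⟩
  · intro b b'
    rw [hcos, hcosA, hresp, hη, hη]
  · intro a
    refine ⟨ξ a, ?_⟩
    rw [hcosA, hresp, hη]
  · intro b b'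
    rw [hcosA, hresp, hη, hdmul, hp.map_dmul, hp.map_dmul, hη, hη]
  · intro b b'
    rw [hcosA, hresp, hη, hcmul, hp.map_cmul, hp.map_cmul, hη, hη]
  · rw [← (hτ x hx).2, ← (hτ y hy).2, hxy]
  · have hy' := h.theta_maps y hy
    exact ⟨θ y, hy', h.theta_inj _ (hτ _ hy').1 _ hy (hτ _ hy').2⟩
  · have hxy : dmul x y ∈ Asub B n := dclosure.mul hx hy
    refine h.theta_inj _ (hτ _ hxy).1 _ (dclosure.mul (hτ x hx).1 (hτ y hy).1) ?_
    rw [(hτ _ hxy).2, h.theta_dmul _ (hτ x hx).1 _ (hτ y hy).1, (hτ x hx).2, (hτ y hy).2]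
  · have hxy : cmul x y ∈ asubSubgroup B n := by
      rw [cmul_eq]; exact mul_mem hx (lam_mem_asub x hy)
    have hxy' : cmul (τ x) (τ y) ∈ asubSubgroup A n := by
      rw [cmul_eq]; exact mul_mem (hτ x hx).1 (lam_mem_asub _ (hτ y hy).1)
    refine h.theta_inj _ (hτ _ hxy).1 _ hxy' ?_
    rw [(hτ _ hxy).2, h.theta_cmul _ (hτ x hx).1 _ (hτ y hy).1, (hτ x hx).2, (hτ y hy).2]
  · have he := evalW_mem_asub e a n
    refine h.theta_inj _ (hτ _ he).1 _ (evalW_mem_asub e b n) ?_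
    rw [(hτ _ he).2]
    refine (hcompat e b a fun i hi => ?_).symm
    have hi := hab i hi
    rw [hcosA, hresp, hη] at hi
    exact hi.symm

theorem IsBraceHom.isoclinicN_of_ker {C : Type v} [SkewBrace C] {g : A → C}
    (hA : IsSymmetric A) {n : ℕ} {I : Set A} (hf : IsBraceHom f) (hs : Function.Surjective f)
    (hfk : ∀ a, f a = 1 ↔ a ∈ I) (hg : IsBraceHom g) (hgs : Function.Surjective g)
    (hgk : ∀ a, g a = 1 ↔ a ∈ I ∩ Gamma A (n + 1)) : IsoclinicN B C n := by
  have hC := hA.of_surjective hg hgs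
  have hle : ∀ x y, g x = g y → f x = f y := by
    intro x y h
    rw [hg.eq_iff hgk] at h
    exact (hf.eq_iff hfk).2 h.1
  choose r hr using hgs
  have hrg : ∀ a, f (r (g a)) = f a := fun a => hle _ _ (hr _)
  have hh : IsBraceHom fun c => f (r c) := by
    constructor
    · intro x y
      rw [← hf.map_dmul]
      exact hle _ _ (by rw [hg.map_dmul, hr, hr, hr])
    · intro x y
      rw [← hf.map_cmul]
      exact hle _ _ (by rw [hg.map_cmul, hr, hr, hr])
  refine (hh.isoclinicN hC (fun b => ?_) fun x hx hx1 => ?_).symm hC (hA.of_surjective hf hs)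
  · obtain ⟨a, rfl⟩ := hs b
    exact ⟨g a, hrg a⟩
  · rw [← hC.asub_eq_gamma, ← hg.image_asub (fun c => ⟨r c, hr c⟩)] at hx
    obtain ⟨y, hy, rfl⟩ := hx
    rw [hrg, hfk] at hx1
    exact (hgk y).2 ⟨hx1, asub_subset_gamma n hy⟩

/-- An `n`-isoclinism onto a quotient forces the quotient map to be injective on a finite
`Γ_{n+1}`. -/
theorem IsoclinicN.eq_one_of_map_eq_one (hA : IsSymmetric A) {n : ℕ}
    (hfin : (Gamma A (n + 1)).Finite) (hf : IsBraceHom f) (hs : Function.Surjective f)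
    (h : IsoclinicN A B n) {x : A} (hx : x ∈ Gamma A (n + 1)) (hfx : f x = 1) : x = 1 := by
  obtain ⟨ξ, θ, h⟩ := h
  rw [← hA.asub_eq_gamma] at hfin hx
  have hθ : θ '' Asub A n = Asub B n := by
    apply Set.Subset.antisymm
    · rintro _ ⟨x, hx, rfl⟩
      exact h.theta_maps x hx
    · exact fun y hy => h.theta_surj y hy
  have hθi : Set.InjOn θ (Asub A n) := fun x hx y hy => h.theta_inj x hx y hy
  have hcard : (f '' Asub A n).ncard = (Asub A n).ncard := by
    rw [hf.image_asub hs, ← hθ, hθi.ncard_image]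
  have hfi := Set.injOn_of_ncard_image_eq hcard hfin
  exact hfi hx (one_mem (asubSubgroup A n)) (hfx.trans hf.map_one.symm)

end Isoclinism

end Helpers

end SkewBrace

open SkewBrace in
/-- Let `A` be a symmetric skew brace, `I` an ideal of `A` and `n ≥ 1`. Then `A/I` is
`n`-isoclinic to `A/(I ∩ Γ_{n+1}(A))` (quotients are encoded as surjective brace-homomorphic
images with the prescribed kernel); in particular, if `I ∩ Γ_{n+1}(A) = 1` then `A` and `A/I`
are `n`-isoclinic. Conversely, if `Γ_{n+1}(A)` is finite and `A` and `A/I` are `n`-isoclinic,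
then `I ∩ Γ_{n+1}(A) = 1`. -/
theorem quotient_isoclinicN {A : Type u} [SkewBrace A] (hA : IsSymmetric A)
    (n : ℕ) (hn : 1 ≤ n) (I : Set A) (hI : IsIdeal A I) :
    (∀ (B C : Type u) [SkewBrace B] [SkewBrace C] (f : A → B) (g : A → C),
      IsBraceHom f → Function.Surjective f → (∀ a : A, f a = ident ↔ a ∈ I) →
      IsBraceHom g → Function.Surjective g →
      (∀ a : A, g a = ident ↔ a ∈ I ∩ Gamma A (n + 1)) →
      IsoclinicN B C n) ∧
    (I ∩ Gamma A (n + 1) = {ident} →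
      ∀ (B : Type u) [SkewBrace B] (f : A → B),
        IsBraceHom f → Function.Surjective f → (∀ a : A, f a = ident ↔ a ∈ I) →
        IsoclinicN A B n) ∧
    ((Gamma A (n + 1)).Finite →
      ∀ (B : Type u) [SkewBrace B] (f : A → B),
        IsBraceHom f → Function.Surjective f → (∀ a : A, f a = ident ↔ a ∈ I) →
        IsoclinicN A B n → I ∩ Gamma A (n + 1) = {ident}) := by
  refine ⟨fun B C _ _ f g hf hfs hfk hg hgs hgk => hf.isoclinicN_of_ker hA hfs hfk hg hgs hgk,
    fun h B _ f hf hfs hfk => hf.isoclinicN hA hfs fun x hx hfx => ?_,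
    fun hfin B _ f hf hfs hfk h => ?_⟩
  · have hx' : x ∈ I ∩ Gamma A (n + 1) := ⟨(hfk x).1 hfx, hx⟩
    rwa [h] at hx'
  · refine Set.Subset.antisymm (fun x hx => ?_) ?_
    · exact h.eq_one_of_map_eq_one hA hfin hf hfs hx.2 ((hfk x).2 hx.1)
    · rintro _ rfl
      exact ⟨hI.ident_mem, gamma_one_mem _⟩
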